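/- (Spin alignment conjecture, case n = 2 and s = 1/2.) Let x₁₂, x₁, x₂, x₀ be nonnegative reals with x₁₂ + x₁ + x₂ + x₀ = 1. For all density matrices ω₁, ω₂ on ℂ² and every density matrix ω₁₂ on ℂ²⊗ℂ², S( x₁₂·(|1⟩⟨1|⊗|1⟩⟨1|) + x₁·(|1⟩⟨1|⊗I₂/2) + x₂·(I₂/2⊗|1⟩⟨1|) + x₀·(I₂⊗I₂)/4 ) ≤ S( x₁₂·ω₁₂ + x₁·(ω₁⊗I₂/2) + x₂·(I₂/2⊗ω₂) + x₀·(I₂⊗I₂)/4 ). -/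

import Mathlib

open Matrix Kronecker ComplexOrder

/-- Von Neumann entropy (base-2) of a matrix: −∑ λᵢ log₂ λᵢ over its eigenvalues
(0 if the matrix is not Hermitian). -/
noncomputable def vnEntropy {n : Type*} [Fintype n] [DecidableEq n]
    (ρ : Matrix n n ℂ) : ℝ :=
  if h : ρ.IsHermitian then -∑ i, (h.eigenvalues i) * Real.logb 2 (h.eigenvalues i) else 0

/-- The projector |1⟩⟨1| on ℂ². -/
noncomputable def proj1 : Matrix (Fin 2) (Fin 2) ℂ := !![0, 0; 0, 1]

lemma negMulLog_tangent {x y : ℝ} (hx : 0 < x) (hy : 0 < y) :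
    Real.negMulLog y ≤ Real.negMulLog x + (-Real.log x - 1) * (y - x) := by
  have h := Real.log_le_sub_one_of_pos (div_pos hx hy)
  rw [Real.log_div hx.ne' hy.ne'] at h
  have h2 := mul_le_mul_of_nonneg_left h hy.le
  have h3 : y * (x / y - 1) = x - y := by field_simp
  rw [h3] at h2
  unfold Real.negMulLog
  nlinarith

lemma karamata_pos {l1 l2 l3 l4 m1 m2 m3 m4 : ℝ} (s1 : l2 ≤ l1) (s2 : l3 ≤ l2) (s3 : l4 ≤ l3)
    (hl : 0 < l4) (p1 : 0 < m1) (p2 : 0 < m2) (p3 : 0 < m3) (p4 : 0 < m4)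
    (k1 : l1 ≤ m1) (k2 : l1 + l2 ≤ m1 + m2) (k3 : m4 ≤ l4)
    (k4 : l1 + l2 + l3 + l4 = m1 + m2 + m3 + m4) :
    Real.negMulLog m1 + Real.negMulLog m2 + Real.negMulLog m3 + Real.negMulLog m4 ≤
    Real.negMulLog l1 + Real.negMulLog l2 + Real.negMulLog l3 + Real.negMulLog l4 := by
  have t1 := negMulLog_tangent (x := l1) (by linarith) p1
  have t2 := negMulLog_tangent (x := l2) (by linarith) p2
  have t3 := negMulLog_tangent (x := l3) (by linarith) p3
  have t4 := negMulLog_tangent (x := l4) (by linarith) p4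
  have g1 := Real.log_le_log (by linarith) s1
  have g2 := Real.log_le_log (by linarith) s2
  have g3 := Real.log_le_log (by linarith) s3
  have e1 := mul_nonneg (sub_nonneg.2 g1) (sub_nonneg.2 k1)
  have e2 := mul_nonneg (sub_nonneg.2 g2) (sub_nonneg.2 k2)
  have e3 := mul_nonneg (sub_nonneg.2 g3) (sub_nonneg.2 k3)
  obtain rfl : m4 = l1 + l2 + l3 + l4 - m1 - m2 - m3 := by linarith
  nlinarith

lemma karamata_nonneg {l1 l2 l3 l4 m1 m2 m3 m4 : ℝ}
    (s1 : l2 ≤ l1) (s2 : l3 ≤ l2) (s3 : l4 ≤ l3)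
    (hl : 0 ≤ l4) (p1 : 0 ≤ m1) (p2 : 0 ≤ m2) (p3 : 0 ≤ m3) (p4 : 0 ≤ m4)
    (k1 : l1 ≤ m1) (k2 : l1 + l2 ≤ m1 + m2) (k3 : m4 ≤ l4)
    (k4 : l1 + l2 + l3 + l4 = m1 + m2 + m3 + m4) :
    Real.negMulLog m1 + Real.negMulLog m2 + Real.negMulLog m3 + Real.negMulLog m4 ≤
    Real.negMulLog l1 + Real.negMulLog l2 + Real.negMulLog l3 + Real.negMulLog l4 := by
  have c (a b c d : ℝ) : Filter.Tendsto (fun e : ℝ => Real.negMulLog (a + e) +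
      Real.negMulLog (b + e) + Real.negMulLog (c + e) + Real.negMulLog (d + e))
      (nhdsWithin 0 (Set.Ioi 0)) (nhds (Real.negMulLog a +
      Real.negMulLog b + Real.negMulLog c + Real.negMulLog d)) := by
    have hc : Continuous (fun e : ℝ => Real.negMulLog (a + e) +
      Real.negMulLog (b + e) + Real.negMulLog (c + e) + Real.negMulLog (d + e)) := by
      fun_prop
    have := hc.tendsto 0
    simp only [add_zero] at this
    exact this.mono_left nhdsWithin_le_nhds
  refine le_of_tendsto_of_tendsto (c m1 m2 m3 m4) (c l1 l2 l3 l4) ?_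
  filter_upwards [self_mem_nhdsWithin] with e he
  have he : 0 < e := he
  apply karamata_pos <;> linarith

lemma numeric (l p : Fin 4 → ℝ) (w M m d : ℝ) (hw : 0 ≤ w) (hm : 0 ≤ m) (hmM : m ≤ M)
    (hd : 0 ≤ d) (hp : ∀ i, 0 ≤ p i) (hps : ∑ i, p i = w + m)
    (hlp : ∀ i, l i ≤ p i + (M + d)) (hl : ∀ i, d ≤ l i)
    (hls : ∑ i, l i = w + 2 * M + 2 * m + 4 * d) :
    Real.negMulLog (w + M + m + d) + Real.negMulLog (M + d) + Real.negMulLog (m + d)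
      + Real.negMulLog d ≤ ∑ i, Real.negMulLog (l i) := by
  have hs := Tuple.monotone_sort l
  set σ := Tuple.sort l
  rw [← Equiv.sum_comp σ] at hps hls ⊢
  have a1 : l (σ 0) ≤ l (σ 1) := hs (by decide)
  have a2 : l (σ 1) ≤ l (σ 2) := hs (by decide)
  have a3 : l (σ 2) ≤ l (σ 3) := hs (by decide)
  simp only [Fin.sum_univ_four] at hps hls ⊢
  have := hp (σ 0); have := hp (σ 1); have := hp (σ 2); have := hp (σ 3)
  have := hlp (σ 3); have := hlp (σ 2); have := hl (σ 0)
  have := karamata_nonneg (l1 := l (σ 3)) (l2 := l (σ 2)) (l3 := l (σ 1)) (l4 := l (σ 0))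
    (m1 := w + M + m + d) (m2 := M + d) (m3 := m + d) (m4 := d) a3 a2 a1
    (by linarith) (by linarith) (by linarith) (by linarith) (by linarith) (by linarith)
    (by linarith) (by linarith) (by linarith)
  linarith

lemma spectral_bounds {n : Type*} [Fintype n] [DecidableEq n] (M P : Matrix n n ℂ) (t d w : ℝ)
    (hM : M.IsHermitian) (hP : P.PosSemidef) (hPt : P.trace = (w : ℂ))
    (h1 : (P + (t : ℂ) • 1 - M).PosSemidef) (h2 : (M - (d : ℂ) • 1).PosSemidef) :
    ∃ p : n → ℝ, (∀ i, 0 ≤ p i) ∧ ∑ i, p i = w ∧ (∀ i, hM.eigenvalues i ≤ p i + t) ∧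
      ∀ i, d ≤ hM.eigenvalues i := by
  set U : Matrix n n ℂ := hM.eigenvectorUnitary.1 with hU
  have hUU : Uᴴ * U = 1 := Unitary.coe_star_mul_self hM.eigenvectorUnitary
  have hUU' : U * Uᴴ = 1 := Unitary.coe_mul_star_self hM.eigenvectorUnitary
  have hD : Uᴴ * M * U = diagonal (fun i => (hM.eigenvalues i : ℂ)) := by
    have := hM.conjStarAlgAut_star_eigenvectorUnitary
    rw [Unitary.conjStarAlgAut_star_apply] at this
    exact this
  have e1 := hP.conjTranspose_mul_mul_same U
  have e2 := h1.conjTranspose_mul_mul_same U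
  have e3 := h2.conjTranspose_mul_mul_same U
  have r1 : Uᴴ * (P + (t : ℂ) • 1 - M) * U = Uᴴ * P * U + (t : ℂ) • 1 -
      diagonal (fun i => (hM.eigenvalues i : ℂ)) := by
    rw [← hD]; simp [mul_sub, sub_mul, mul_add, add_mul, hUU]
  have r2 : Uᴴ * (M - (d : ℂ) • 1) * U = 
      diagonal (fun i => (hM.eigenvalues i : ℂ)) - (d : ℂ) • 1 := by
    rw [← hD]; simp [mul_sub, sub_mul, hUU]
  rw [r1] at e2
  rw [r2] at e3
  refine ⟨fun i => ((Uᴴ * P * U) i i).re, fun i => ?_, ?_, fun i => ?_, fun i => ?_⟩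
  · exact (Complex.le_def.1 (e1.diag_nonneg (i := i))).1
  · have : (Uᴴ * P * U).trace = w := by
      rw [Matrix.trace_mul_cycle, hUU', one_mul, hPt]
    have := congrArg Complex.re this
    simpa [Matrix.trace] using this
  · have := (Complex.le_def.1 (e2.diag_nonneg (i := i))).1
    simp at this
    linarith
  · have := (Complex.le_def.1 (e3.diag_nonneg (i := i))).1
    simp at this
    linarith

lemma vn_eq {n : Type*} [Fintype n] [DecidableEq n] (ρ : Matrix n n ℂ) (h : ρ.IsHermitian) :
    vnEntropy ρ = (∑ i, Real.negMulLog (h.eigenvalues i)) / Real.log 2 := by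
  rw [vnEntropy, dif_pos h, Finset.sum_div, ← Finset.sum_neg_distrib]
  refine Finset.sum_congr rfl fun i _ => ?_
  rw [Real.negMulLog, Real.logb]; ring

lemma vn_diag {n : Type*} [Fintype n] [DecidableEq n] (f : n → ℝ) :
    vnEntropy (diagonal (fun i => (f i : ℂ))) = (∑ i, Real.negMulLog (f i)) / Real.log 2 := by
  have h : (diagonal (fun i => (f i : ℂ))).IsHermitian := by
    apply isHermitian_diagonal_of_self_adjoint
    ext i; simp
  rw [vn_eq _ h]
  congr 1
  have e1 := h.roots_charpoly_eq_eigenvalues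
  rw [charpoly_diagonal, Polynomial.roots_prod _ _ (by
    rw [Finset.prod_ne_zero_iff]; intro i _; exact Polynomial.X_sub_C_ne_zero _)] at e1
  simp only [Polynomial.roots_X_sub_C, Multiset.bind_singleton] at e1
  have e2 := congrArg (fun s => (s.map (fun z : ℂ => Real.negMulLog z.re)).sum) e1
  simp only [Multiset.map_map] at e2
  exact e2.symm

lemma sub_kron {m n : Type*} (A B : Matrix m m ℂ) (C : Matrix n n ℂ) :
    (A - B) ⊗ₖ C = A ⊗ₖ C - B ⊗ₖ C := by
  ext ⟨i, j⟩ ⟨k, l⟩; simp [sub_mul]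

lemma kron_sub {m n : Type*} (A : Matrix m m ℂ) (B C : Matrix n n ℂ) :
    A ⊗ₖ (B - C) = A ⊗ₖ B - A ⊗ₖ C := by
  ext ⟨i, j⟩ ⟨k, l⟩; simp [mul_sub]

lemma compl_psd (ω : Matrix (Fin 2) (Fin 2) ℂ) (h : ω.PosSemidef) (ht : ω.trace = 1) :
    (1 - ω).PosSemidef := by
  have e : 1 - ω = !![0, 1; -1, 0]ᴴ * ωᵀ * !![0, 1; -1, 0] := by
    rw [Matrix.trace_fin_two] at ht
    ext i j
    fin_cases i <;> fin_cases j <;> simp [Matrix.mul_apply, Fin.sum_univ_two] <;>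
      first | linear_combination ht | linear_combination -ht
  rw [e]
  exact h.transpose.conjTranspose_mul_mul_same _

lemma rs {n : Type*} [Fintype n] {A : Matrix n n ℂ} (hA : A.PosSemidef) {c : ℝ} (hc : 0 ≤ c) :
    ((c : ℂ) • A).PosSemidef := hA.smul (by exact_mod_cast hc)

/-- Spin alignment conjecture for n = 2 spins and s = 1/2 (Q = I/2):
the entropy is minimized when all the ω's are spin-down projectors. -/
theorem stmt10 (x12 x1 x2 x0 : ℝ)
    (h12 : 0 ≤ x12) (h1 : 0 ≤ x1) (h2 : 0 ≤ x2) (h0 : 0 ≤ x0)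
    (hsum : x12 + x1 + x2 + x0 = 1)
    (ω1 ω2 : Matrix (Fin 2) (Fin 2) ℂ)
    (hω1 : ω1.PosSemidef) (hω1tr : ω1.trace = 1)
    (hω2 : ω2.PosSemidef) (hω2tr : ω2.trace = 1)
    (ω12 : Matrix (Fin 2 × Fin 2) (Fin 2 × Fin 2) ℂ)
    (hω12 : ω12.PosSemidef) (hω12tr : ω12.trace = 1) :
    vnEntropy ((x12 : ℂ) • (proj1 ⊗ₖ proj1) +
        (x1 : ℂ) • (proj1 ⊗ₖ ((1/2 : ℂ) • (1 : Matrix (Fin 2) (Fin 2) ℂ))) +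
        (x2 : ℂ) • (((1/2 : ℂ) • (1 : Matrix (Fin 2) (Fin 2) ℂ)) ⊗ₖ proj1) +
        (x0 : ℂ) • ((1/4 : ℂ) • (1 : Matrix (Fin 2 × Fin 2) (Fin 2 × Fin 2) ℂ))) ≤
      vnEntropy ((x12 : ℂ) • ω12 +
        (x1 : ℂ) • (ω1 ⊗ₖ ((1/2 : ℂ) • (1 : Matrix (Fin 2) (Fin 2) ℂ))) +
        (x2 : ℂ) • (((1/2 : ℂ) • (1 : Matrix (Fin 2) (Fin 2) ℂ)) ⊗ₖ ω2) +
        (x0 : ℂ) • ((1/4 : ℂ) • (1 : Matrix (Fin 2 × Fin 2) (Fin 2 × Fin 2) ℂ))) := by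
  have eL : (x12 : ℂ) • (proj1 ⊗ₖ proj1) +
        (x1 : ℂ) • (proj1 ⊗ₖ ((1/2 : ℂ) • (1 : Matrix (Fin 2) (Fin 2) ℂ))) +
        (x2 : ℂ) • (((1/2 : ℂ) • (1 : Matrix (Fin 2) (Fin 2) ℂ)) ⊗ₖ proj1) +
        (x0 : ℂ) • ((1/4 : ℂ) • (1 : Matrix (Fin 2 × Fin 2) (Fin 2 × Fin 2) ℂ)) =
      diagonal (fun i => (((fun i : Fin 2 × Fin 2 =>
        (!![x0/4, x2/2 + x0/4; x1/2 + x0/4, x12 + x1/2 + x2/2 + x0/4] i.1 i.2 : ℝ)) i : ℝ) : ℂ)) := by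
    ext ⟨i, j⟩ ⟨k, l⟩
    fin_cases i <;> fin_cases j <;> fin_cases k <;> fin_cases l <;>
      simp [proj1] <;> ring
  rw [eL, vn_diag]
  have eR : (x12 : ℂ) • ω12 +
        (x1 : ℂ) • (ω1 ⊗ₖ ((1/2 : ℂ) • (1 : Matrix (Fin 2) (Fin 2) ℂ))) +
        (x2 : ℂ) • (((1/2 : ℂ) • (1 : Matrix (Fin 2) (Fin 2) ℂ)) ⊗ₖ ω2) +
        (x0 : ℂ) • ((1/4 : ℂ) • (1 : Matrix (Fin 2 × Fin 2) (Fin 2 × Fin 2) ℂ)) =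
      (x12 : ℂ) • ω12 + ((x1/2 : ℝ) : ℂ) • (ω1 ⊗ₖ (1 : Matrix (Fin 2) (Fin 2) ℂ)) +
      ((x2/2 : ℝ) : ℂ) • ((1 : Matrix (Fin 2) (Fin 2) ℂ) ⊗ₖ ω2) + ((x0/4 : ℝ) : ℂ) • 1 := by
    simp only [kronecker_smul, smul_kronecker, smul_smul]
    push_cast
    simp only [mul_one_div]
  rw [eR]
  have k1 : (ω1 ⊗ₖ (1 : Matrix (Fin 2) (Fin 2) ℂ)).PosSemidef := hω1.kronecker .one
  have k2 : ((1 : Matrix (Fin 2) (Fin 2) ℂ) ⊗ₖ ω2).PosSemidef := PosSemidef.one.kronecker hω2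
  have c1 := compl_psd ω1 hω1 hω1tr
  have c2 := compl_psd ω2 hω2 hω2tr
  have k3 : (1 - ω1 ⊗ₖ (1 : Matrix (Fin 2) (Fin 2) ℂ)).PosSemidef := by
    have := c1.kronecker (PosSemidef.one (n := Fin 2) (R := ℂ))
    rwa [sub_kron, one_kronecker_one] at this
  have k4 : (1 - (1 : Matrix (Fin 2) (Fin 2) ℂ) ⊗ₖ ω2).PosSemidef := by
    have := (PosSemidef.one (n := Fin 2) (R := ℂ)).kronecker c2
    rwa [kron_sub, one_kronecker_one] at this
  have k5 : (1 + ω1 ⊗ₖ ω2 - ω1 ⊗ₖ (1 : Matrix (Fin 2) (Fin 2) ℂ)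
      - (1 : Matrix (Fin 2) (Fin 2) ℂ) ⊗ₖ ω2).PosSemidef := by
    have := c1.kronecker c2
    rw [sub_kron, kron_sub, kron_sub, one_kronecker_one] at this
    have hg : ∀ E F G H : Matrix (Fin 2 × Fin 2) (Fin 2 × Fin 2) ℂ,
        E + H - F - G = E - G - (F - H) := fun E F G H => by abel
    rw [hg]
    exact this
  have k6 := hω1.kronecker hω2
  have t1 : (ω1 ⊗ₖ (1 : Matrix (Fin 2) (Fin 2) ℂ)).trace = 2 := by
    rw [trace_kronecker, hω1tr]; simp
  have t2 : ((1 : Matrix (Fin 2) (Fin 2) ℂ) ⊗ₖ ω2).trace = 2 := by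
    rw [trace_kronecker, hω2tr]; simp
  have t3 : (ω1 ⊗ₖ ω2).trace = 1 := by
    rw [trace_kronecker, hω2tr, hω1tr]; simp
  generalize ω1 ⊗ₖ (1 : Matrix (Fin 2) (Fin 2) ℂ) = A at *
  generalize (1 : Matrix (Fin 2) (Fin 2) ℂ) ⊗ₖ ω2 = B at *
  generalize ω1 ⊗ₖ ω2 = C at *
  have hMd : ((x12 : ℂ) • ω12 + ((x1/2 : ℝ) : ℂ) • A + ((x2/2 : ℝ) : ℂ) • B).PosSemidef :=
    ((rs hω12 h12).add (rs k1 (by linarith))).add (rs k2 (by linarith))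
  have hMp := hMd.add (rs PosSemidef.one (show 0 ≤ x0/4 by linarith))
  have hM := hMp.isHermitian
  rw [vn_eq _ hM]
  have hlog : 0 < Real.log 2 := Real.log_pos (by norm_num)
  refine div_le_div_of_nonneg_right ?_ hlog.le
  have htr : ∑ i, hM.eigenvalues i = x12 + x1 + x2 + x0 := by
    have h3 := hM.trace_eq_sum_eigenvalues
    have h4 : ((x12 : ℂ) • ω12 + ((x1/2 : ℝ) : ℂ) • A + ((x2/2 : ℝ) : ℂ) • B +
        ((x0/4 : ℝ) : ℂ) • 1).trace = ((x12 + x1 + x2 + x0 : ℝ) : ℂ) := by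
      simp [trace_add, trace_smul, t1, t2, hω12tr]
    rw [h4] at h3
    have h5 := congrArg Complex.re h3
    rw [Complex.ofReal_re, Complex.re_sum] at h5
    exact h5.symm
  obtain ⟨M, m, hmM, hm, hMm, hph, hpsd⟩ : ∃ M m : ℝ, m ≤ M ∧ 0 ≤ m ∧ M + m = x1/2 + x2/2 ∧
      Real.negMulLog (M + x0/4) + Real.negMulLog (m + x0/4) = 
        Real.negMulLog (x1/2 + x0/4) + Real.negMulLog (x2/2 + x0/4) ∧
      (((x12 : ℂ) • ω12 + (m : ℂ) • C) + ((M + x0/4 : ℝ) : ℂ) • 1 -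
       ((x12 : ℂ) • ω12 + ((x1/2 : ℝ) : ℂ) • A + ((x2/2 : ℝ) : ℂ) • B +
        ((x0/4 : ℝ) : ℂ) • 1)).PosSemidef := by
    rcases le_total x1 x2 with h | h
    · refine ⟨x2/2, x1/2, by linarith, by linarith, by ring, by ring, ?_⟩
      convert (rs k5 (show 0 ≤ x1/2 by linarith)).add (rs k4 (show 0 ≤ x2/2 - x1/2 by linarith))
        using 1
      push_cast
      module
    · refine ⟨x1/2, x2/2, by linarith, by linarith, by ring, by ring, ?_⟩
      convert (rs k5 (show 0 ≤ x2/2 by linarith)).add (rs k3 (show 0 ≤ x1/2 - x2/2 by linarith))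
        using 1
      push_cast
      module
  obtain ⟨p, p0, ps, pl, ld⟩ := spectral_bounds _ ((x12 : ℂ) • ω12 + (m : ℂ) • C) (M + x0/4)
    (x0/4) (x12 + m) hM ((rs hω12 h12).add (rs k6 hm))
    (by simp [trace_add, trace_smul, t3, hω12tr]) hpsd (by simpa using hMd)
  let e : Fin 4 ≃ Fin 2 × Fin 2 := (finProdFinEquiv (m := 2) (n := 2)).symm
  have := numeric (hM.eigenvalues ∘ e) (p ∘ e) x12 M m (x0/4) h12 hm hmM (by linarith)
    (fun i => p0 _) (by rw [← ps]; exact Equiv.sum_comp e p) (fun i => pl _) (fun i => ld _)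
    (by
      have : ∑ i, (hM.eigenvalues ∘ e) i = ∑ i, hM.eigenvalues i :=
        Equiv.sum_comp e hM.eigenvalues
      rw [this, htr]; linarith)
  have e2 : ∑ i, Real.negMulLog ((hM.eigenvalues ∘ e) i) =
      ∑ i, Real.negMulLog (hM.eigenvalues i) :=
    Equiv.sum_comp e (fun i => Real.negMulLog (hM.eigenvalues i))
  rw [e2] at this
  refine le_trans (le_of_eq ?_) this
  have e3 : x12 + M + m + x0/4 = x12 + x1/2 + x2/2 + x0/4 := by linarith
  rw [e3]
  simp [Fintype.sum_prod_type]
  linarith
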